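/- Let B be a unital C*-algebra and let 𝔗 be a strongly continuous CPD-semigroup on a set S with values in the bounded linear maps on B (that is, t ↦ 𝔗_t^{s,s'}(b) is norm continuous for all s,s' ∈ S, b ∈ B). If 𝔗 is spatial, then 𝔗 is uniformly continuous: for all s,s' ∈ S the map t ↦ 𝔗_t^{s,s'} is continuous on [0,∞) with respect to the operator norm on bounded linear maps B → B. -/

import Mathlib

open scoped NNReal

/-- A kernel `K` on a set `S` with values in the bounded linear maps on a unital
C*-algebra `B` is *completely positive definite* (CPD) if all finite sums
`∑_{i,j} bᵢ* K^{sᵢ,sⱼ}(aᵢ* aⱼ) bⱼ` are positive, i.e. of the form `y* y`. -/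
def IsCPDKernel {S : Type*} {B : Type*} [CStarAlgebra B]
    (K : S → S → B →L[ℂ] B) : Prop :=
  ∀ (n : ℕ) (s : Fin n → S) (a b : Fin n → B),
    ∃ y : B, ∑ i, ∑ j, star (b i) * K (s i) (s j) (star (a i) * a j) * b j = star y * y

/-- A CPD-semigroup on `S`: a family of CPD-kernels with `𝔗₀ = id` and
`𝔗_{t+u}^{s,s'} = 𝔗_t^{s,s'} ∘ 𝔗_u^{s,s'}`. -/
def IsCPDSemigroup {S : Type*} {B : Type*} [CStarAlgebra B]
    (T : ℝ≥0 → S → S → B →L[ℂ] B) : Prop :=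
  (∀ t, IsCPDKernel (T t)) ∧
  (∀ s s', T 0 s s' = ContinuousLinearMap.id ℂ B) ∧
  (∀ t u s s', T (t + u) s s' = (T t s s').comp (T u s s'))

/-- A one-parameter semigroup in `B`. -/
def IsOneParamSemigroup {B : Type*} [CStarAlgebra B] (c : ℝ≥0 → B) : Prop :=
  c 0 = 1 ∧ ∀ t u, c (t + u) = c t * c u

/-- The elementary CPD-semigroup implemented by the family of semigroups `c`:
`𝔖_t^{s,s'}(b) = (c^s_t)* b (c^{s'}_t)`. -/
noncomputable def elemCPD {S : Type*} {B : Type*} [CStarAlgebra B]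
    (c : S → ℝ≥0 → B) (t : ℝ≥0) (s s' : S) : B →L[ℂ] B :=
  ContinuousLinearMap.mulLeftRight ℂ B (star (c s t)) (c s' t)

/-- The family `c` of norm-continuous one-parameter semigroups implements a *unit*
for the CPD-semigroup `T`, i.e. `T` dominates the elementary CPD-semigroup of `c`. -/
def IsUnitFor {S : Type*} {B : Type*} [CStarAlgebra B]
    (c : S → ℝ≥0 → B) (T : ℝ≥0 → S → S → B →L[ℂ] B) : Prop :=
  (∀ s, Continuous (c s) ∧ IsOneParamSemigroup (c s)) ∧
  (∀ t, IsCPDKernel (fun s s' => T t s s' - elemCPD c t s s'))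

/-- A CPD-semigroup is *spatial* if it admits a unit. -/
def IsSpatialCPDSemigroup {S : Type*} {B : Type*} [CStarAlgebra B]
    (T : ℝ≥0 → S → S → B →L[ℂ] B) : Prop :=
  ∃ c, IsUnitFor c T

open Filter Topology

section Order

variable {S B : Type*} [CStarAlgebra B] [PartialOrder B] [StarOrderedRing B]
  {K : S → S → B →L[ℂ] B}

lemma IsCPDKernel.apply_star_mul_self_nonneg (hK : IsCPDKernel K) (s : S) (a : B) :
    0 ≤ K s s (star a * a) := by
  obtain ⟨y, hy⟩ := hK 1 (fun _ => s) (fun _ => a) (fun _ => 1)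
  simp only [Finset.univ_unique, Finset.sum_const, Finset.card_singleton, one_smul, star_one,
    one_mul, mul_one] at hy
  exact hy ▸ star_mul_self_nonneg y

lemma IsCPDKernel.norm_apply_star_mul_self_le (hK : IsCPDKernel K) (s : S) {a : B}
    (ha : ‖a‖ ≤ 1) : ‖K s s (star a * a)‖ ≤ ‖K s s 1‖ := by
  refine CStarAlgebra.norm_le_norm_of_nonneg_of_le (hK.apply_star_mul_self_nonneg s a) ?_
  have h : star a * a ≤ 1 := by
    refine (CStarAlgebra.norm_le_one_iff_of_nonneg _ (star_mul_self_nonneg a)).1 ?_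
    rw [CStarRing.norm_star_mul_self]
    exact mul_le_one₀ ha (norm_nonneg a) ha
  obtain ⟨y, hy⟩ := CStarAlgebra.nonneg_iff_eq_star_mul_self.1 (sub_nonneg.2 h)
  rw [← sub_nonneg, ← map_sub, hy]
  exact hK.apply_star_mul_self_nonneg s y

lemma IsCPDKernel.two_point_nonneg (hK : IsCPDKernel K) (s s' : S) (a : B) (z : ℂ) :
    0 ≤ K s s 1 + z • K s s' a + star z • K s' s (star a)
      + (star z * z) • K s' s' (star a * a) := by
  obtain ⟨y, hy⟩ := hK 2 ![s, s'] ![1, a] ![1, algebraMap ℂ B z]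
  have h : K s s 1 + z • K s s' a + star z • K s' s (star a)
      + (star z * z) • K s' s' (star a * a) = star y * y := by
    rw [← hy]
    simp [Fin.sum_univ_two, Algebra.algebraMap_eq_smul_one, smul_smul, mul_comm]
    abel
  exact h ▸ star_mul_self_nonneg y

lemma norm_le_of_add_nonneg_of_sub_nonneg {a x : B} (h₁ : 0 ≤ a + x) (h₂ : 0 ≤ a - x) :
    ‖x‖ ≤ 3 * ‖a‖ := by
  have h : ‖a + x‖ ≤ ‖a + a‖ :=
    CStarAlgebra.norm_le_norm_of_nonneg_of_le h₁ (by gcongr; exact sub_nonneg.1 h₂)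
  calc ‖x‖ = ‖(a + x) - a‖ := by rw [add_sub_cancel_left]
    _ ≤ ‖a + x‖ + ‖a‖ := norm_sub_le _ _
    _ ≤ 3 * ‖a‖ := by linarith [norm_add_le a a]

lemma IsCPDKernel.norm_apply_le (hK : IsCPDKernel K) (s s' : S) {a : B} (ha : ‖a‖ ≤ 1) :
    ‖K s s' a‖ ≤ 3 * (‖K s s 1‖ + ‖K s' s' 1‖) := by
  set P := K s s 1
  set Q := K s' s' (star a * a)
  set X := K s s' a
  set Y := K s' s (star a)
  have hPQ : ‖P + Q‖ ≤ ‖P‖ + ‖K s' s' 1‖ :=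
    (norm_add_le _ _).trans (by gcongr; exact hK.norm_apply_star_mul_self_le s' ha)
  have hre : ‖X + Y‖ ≤ 3 * ‖P + Q‖ := by
    refine norm_le_of_add_nonneg_of_sub_nonneg ?_ ?_
    · convert hK.two_point_nonneg s s' a 1 using 1
      simp only [P, Q, X, Y, one_smul, star_one, mul_one]
      abel
    · convert hK.two_point_nonneg s s' a (-1) using 1
      simp only [P, Q, X, Y, one_smul, star_one, mul_one, star_neg, neg_smul, neg_mul_neg]
      abel
  have him : ‖Complex.I • (X - Y)‖ ≤ 3 * ‖P + Q‖ := by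
    refine norm_le_of_add_nonneg_of_sub_nonneg ?_ ?_
    · convert hK.two_point_nonneg s s' a Complex.I using 1
      simp [P, Q, X, Y, smul_sub]
      abel
    · convert hK.two_point_nonneg s s' a (-Complex.I) using 1
      simp [P, Q, X, Y, smul_sub]
      abel
  rw [norm_smul, Complex.norm_I, one_mul] at him
  have h : ‖(2 : ℂ) • X‖ ≤ ‖X + Y‖ + ‖X - Y‖ := by
    rw [show (2 : ℂ) • X = (X + Y) + (X - Y) by rw [two_smul]; abel]
    exact norm_add_le _ _
  rw [norm_smul, Complex.norm_ofNat] at h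
  linarith

end Order

/-- The operator norm of a CPD-kernel is controlled by the values of its diagonal at `1`. -/
lemma IsCPDKernel.opNorm_le {S B : Type*} [CStarAlgebra B] {K : S → S → B →L[ℂ] B}
    (hK : IsCPDKernel K) (s s' : S) :
    ‖K s s'‖ ≤ 3 * (‖K s s 1‖ + ‖K s' s' 1‖) := by
  let := CStarAlgebra.spectralOrder B
  have := CStarAlgebra.spectralOrderedRing B
  refine ContinuousLinearMap.opNorm_le_of_unit_norm (𝕜 := ℂ) (by positivity) fun a ha => ?_
  exact hK.norm_apply_le s s' ha.le

/-- A strongly continuous semigroup of operators that is norm continuous at `0`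
is norm continuous. -/
lemma continuous_of_semigroup_of_tendsto_zero {E : Type*} [NormedAddCommGroup E]
    [NormedSpace ℂ E] [CompleteSpace E] {T : ℝ≥0 → E →L[ℂ] E}
    (hadd : ∀ t u, T (t + u) = (T t).comp (T u))
    (hstrong : ∀ x, Continuous fun t => T t x)
    (hzero : Tendsto T (𝓝 0) (𝓝 (ContinuousLinearMap.id ℂ E))) : Continuous T := by
  refine continuous_iff_continuousAt.2 fun t => ?_
  obtain ⟨C, hC⟩ := banach_steinhaus (g := fun u : Set.Icc 0 (t + 1) => T u) fun x => by
    obtain ⟨C, hC⟩ := isCompact_Icc.exists_bound_of_continuousOn (hstrong x).continuousOn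
    exact ⟨C, fun u => hC u u.2⟩
  have hle : ∀ v w, v ≤ w → v ≤ t + 1 →
      ‖T w - T v‖ ≤ C * ‖T (w - v) - ContinuousLinearMap.id ℂ E‖ := fun v w hvw hv => by
    have h : T w - T v = (T v).comp (T (w - v) - ContinuousLinearMap.id ℂ E) := by
      rw [ContinuousLinearMap.comp_sub, ← hadd, add_tsub_cancel_of_le hvw,
        ContinuousLinearMap.comp_id]
    rw [h]
    exact (ContinuousLinearMap.opNorm_comp_le _ _).trans
      (by gcongr; exact hC ⟨v, zero_le, hv⟩)
  have hbound : ∀ u, ‖T u - T t‖ ≤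
      C * (‖T (u - t) - ContinuousLinearMap.id ℂ E‖
        + ‖T (t - u) - ContinuousLinearMap.id ℂ E‖) := by
    intro u
    have hC0 : 0 ≤ C := (norm_nonneg _).trans (hC ⟨0, le_rfl, zero_le⟩)
    rcases le_total u t with h | h
    · rw [norm_sub_rev]
      refine (hle u t h (h.trans le_self_add)).trans ?_
      gcongr
      exact le_add_of_nonneg_left (norm_nonneg _)
    · refine (hle t u h le_self_add).trans ?_
      gcongr
      exact le_add_of_nonneg_right (norm_nonneg _)
  have hlim : Tendsto (fun v => ‖T v - ContinuousLinearMap.id ℂ E‖) (𝓝 0) (𝓝 0) :=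
    tendsto_iff_norm_sub_tendsto_zero.1 hzero
  have hsub₁ : Tendsto (fun u => u - t) (𝓝 t) (𝓝 0) := by
    have : Continuous fun u : ℝ≥0 => u - t := by fun_prop
    simpa using this.tendsto t
  have hsub₂ : Tendsto (fun u => t - u) (𝓝 t) (𝓝 0) := by
    have : Continuous fun u : ℝ≥0 => t - u := by fun_prop
    simpa using this.tendsto t
  refine tendsto_iff_norm_sub_tendsto_zero.2 (squeeze_zero (fun _ => norm_nonneg _)
    hbound ?_)
  simpa using ((hlim.comp hsub₁).add (hlim.comp hsub₂)).const_mul C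

lemma continuous_elemCPD {S B : Type*} [CStarAlgebra B] {c : S → ℝ≥0 → B}
    (hc : ∀ s, Continuous (c s)) (s s' : S) : Continuous fun t => elemCPD c t s s' := by
  have h := hc s
  have h' := hc s'
  unfold elemCPD
  fun_prop

lemma elemCPD_zero {S B : Type*} [CStarAlgebra B] {c : S → ℝ≥0 → B}
    (hc : ∀ s, c s 0 = 1) (s s' : S) : elemCPD c 0 s s' = ContinuousLinearMap.id ℂ B := by
  ext b
  simp [elemCPD, hc]

/-- A strongly continuous spatial CPD-semigroup on a unital C*-algebra
is automatically uniformly continuous: each `t ↦ 𝔗_t^{s,s'}` is continuous for the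
operator norm on bounded linear maps `B → B`. -/
theorem spatial_strongly_continuous_CPDSemigroup_uniformly_continuous
    {S : Type*} {B : Type*} [CStarAlgebra B]
    (T : ℝ≥0 → S → S → B →L[ℂ] B)
    (hT : IsCPDSemigroup T)
    (hstrong : ∀ (s s' : S) (b : B), Continuous fun t => T t s s' b)
    (hspatial : IsSpatialCPDSemigroup T) :
    ∀ s s' : S, Continuous fun t => T t s s' := by
  obtain ⟨-, hT0, hadd⟩ := hT
  obtain ⟨c, hc, hdom⟩ := hspatial
  have hS := continuous_elemCPD fun s => (hc s).1
  have hS0 := elemCPD_zero fun s => (hc s).2.1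
  intro s s'
  refine continuous_of_semigroup_of_tendsto_zero (fun t u => hadd t u s s') (hstrong s s') ?_
  have hdiag : ∀ r, Tendsto (fun t => ‖(T t r r - elemCPD c t r r) 1‖) (𝓝 0) (𝓝 0) := fun r => by
    have h : Continuous fun t => ‖T t r r 1 - elemCPD c t r r 1‖ :=
      ((hstrong r r 1).sub ((hS r r).clm_apply continuous_const)).norm
    simpa [hT0, hS0] using h.tendsto 0
  have hdiff : Tendsto (fun t => T t s s' - elemCPD c t s s') (𝓝 0) (𝓝 0) :=
    squeeze_zero_norm (fun t => (hdom t).opNorm_le s s')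
      (by simpa using ((hdiag s).add (hdiag s')).const_mul 3)
  simpa [hS0] using hdiff.add ((hS s s').tendsto 0)
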